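/- For every finite simple graph G on n vertices, E(G) ≤ 2·e₁₁ + Σ_{k=1}^{n} Nₖ·√(3·N_{k,1}/Nₖ + k), where the sum is taken over those k with Nₖ > 0, Nₖ is the number of vertices of G of degree k, and N_{k,1} is the number of leaves of G whose unique neighbor has degree k. -/

import Mathlib

open Finset

namespace GraphEnergy

variable {V : Type*} [Fintype V] [DecidableEq V]

/-- The adjacency matrix of a simple graph over `ℝ` is Hermitian. -/
theorem adjMatrix_isHermitian (G : SimpleGraph V) [DecidableRel G.Adj] :
    (G.adjMatrix ℝ).IsHermitian := by
  ext i j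
  simp [Matrix.conjTranspose_apply, SimpleGraph.adj_comm]

/-- The energy of a finite simple graph: the sum of the absolute values of the
eigenvalues of its adjacency matrix. -/
noncomputable def energy (G : SimpleGraph V) [DecidableRel G.Adj] : ℝ :=
  ∑ i, |(adjMatrix_isHermitian G).eigenvalues i|

/-- The set of inner vertices: vertices of degree at least 2. -/
def innerVerts (G : SimpleGraph V) [DecidableRel G.Adj] : Finset V :=
  univ.filter (fun v => 2 ≤ G.degree v)

/-- The set of leaves: vertices of degree 1. -/
def leaves (G : SimpleGraph V) [DecidableRel G.Adj] : Finset V :=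
  univ.filter (fun v => G.degree v = 1)

/-- The number of neighbors of `v` that are leaves. -/
def leafCount (G : SimpleGraph V) [DecidableRel G.Adj] (v : V) : ℕ :=
  ((G.neighborFinset v).filter (fun w => G.degree w = 1)).card

open scoped Classical in
/-- The number of edges both of whose endpoints are leaves. -/
noncomputable def e11 (G : SimpleGraph V) [DecidableRel G.Adj] : ℕ :=
  (G.edgeFinset.filter (fun e => ∀ v ∈ e, G.degree v = 1)).card

/-- The matrix of eigenvectors `U` of a Hermitian matrix `A` satisfies `A U = U D`. -/
theorem mul_eigenvectorUnitary_apply {A : Matrix V V ℝ} (hA : A.IsHermitian) (v i : V) :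
    (A * (hA.eigenvectorUnitary : Matrix V V ℝ)) v i =
      hA.eigenvalues i * (hA.eigenvectorUnitary : Matrix V V ℝ) v i := by
  have h := congrFun (hA.mulVec_eigenvectorBasis i) v
  simpa [Matrix.mul_apply, Matrix.mulVec, dotProduct, hA.eigenvectorUnitary_apply] using h

/-- The trace norm of a real symmetric matrix is at most the sum of the Euclidean norms of
its rows. -/
theorem sum_abs_eigenvalues_le {A : Matrix V V ℝ} (hA : A.IsHermitian) :
    ∑ i, |hA.eigenvalues i| ≤ ∑ v, √((A * A) v v) := by
  set U := (hA.eigenvectorUnitary : Matrix V V ℝ) with hU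
  have hUU : U * U.conjTranspose = 1 := Unitary.coe_mul_star_self hA.eigenvectorUnitary
  have hUU' : U.conjTranspose * U = 1 := Unitary.coe_star_mul_self hA.eigenvectorUnitary
  have row (v : V) : ∑ i, U v i ^ 2 = 1 := by
    simpa [Matrix.mul_apply, sq] using congrFun (congrFun hUU v) v
  have col (i : V) : ∑ v, U v i ^ 2 = 1 := by
    simpa [Matrix.mul_apply, sq] using congrFun (congrFun hUU' i) i
  have sq_row (v : V) : ∑ i, (hA.eigenvalues i * U v i) ^ 2 = (A * A) v v := by
    have h : (A * U) * (A * U).conjTranspose = A * A := by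
      rw [Matrix.conjTranspose_mul, hA.eq, Matrix.mul_assoc, ← Matrix.mul_assoc U, hUU,
        Matrix.one_mul]
    rw [← h, Matrix.mul_apply]
    refine sum_congr rfl fun i _ => ?_
    rw [Matrix.conjTranspose_apply, hU, mul_eigenvectorUnitary_apply, star_trivial, sq]
  calc ∑ i, |hA.eigenvalues i|
      = ∑ i, ∑ v, |hA.eigenvalues i| * U v i ^ 2 := by simp [← mul_sum, col]
    _ = ∑ v, ∑ i, |hA.eigenvalues i * U v i| * |U v i| := by
        rw [sum_comm]
        refine sum_congr rfl fun v _ => sum_congr rfl fun i _ => ?_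
        rw [abs_mul, mul_assoc, abs_mul_abs_self, sq]
    _ ≤ ∑ v, √((A * A) v v) := by
        refine sum_le_sum fun v _ => ?_
        have h := Real.sum_mul_le_sqrt_mul_sqrt univ (fun i => |hA.eigenvalues i * U v i|)
          (fun i => |U v i|)
        simpa only [sq_abs, sq_row, row, Real.sqrt_one, mul_one] using h

/-- The energy of a graph is at most the sum of the square roots of its degrees. -/
theorem energy_le_sum_sqrt_degree (G : SimpleGraph V) [DecidableRel G.Adj] :
    energy G ≤ ∑ v, √(G.degree v : ℝ) := by
  simpa only [energy, SimpleGraph.adjMatrix_mul_self_apply_self] using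
    sum_abs_eigenvalues_le (adjMatrix_isHermitian G)

/-- `E(G) ≤ 2 e₁₁ + ∑_{k=1}^{n} Nₖ √(3 N_{k,1}/Nₖ + k)`, where the sum runs over
those `k ∈ {1, …, n}` with `Nₖ > 0`, `Nₖ` is the number of vertices of degree `k`
and `N_{k,1}` is the number of leaves whose unique neighbor has degree `k`. -/
theorem energy_le_degree_count_bound (G : SimpleGraph V) [DecidableRel G.Adj]
    (Nk Nk1 : ℕ → ℕ)
    (hNk : ∀ k, Nk k = (univ.filter (fun v => G.degree v = k)).card)
    (hNk1 : ∀ k, Nk1 k = (univ.filter (fun v : V =>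
      G.degree v = 1 ∧ ∃ w ∈ G.neighborFinset v, G.degree w = k)).card) :
    energy G ≤ 2 * (e11 G : ℝ) +
      ∑ k ∈ (Finset.Icc 1 (Fintype.card V)).filter (fun k => 0 < Nk k),
        (Nk k : ℝ) * Real.sqrt (3 * (Nk1 k : ℝ) / (Nk k : ℝ) + (k : ℝ)) := by
  have hfiber : ∑ v, √(G.degree v : ℝ) =
      ∑ k ∈ (Icc 1 (Fintype.card V)).filter (fun k => 0 < Nk k), (Nk k : ℝ) * √(k : ℝ) := by
    have hpos : ∑ v, √(G.degree v : ℝ) =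
        ∑ v ∈ univ.filter (fun v => G.degree v ≠ 0), √(G.degree v : ℝ) := by
      refine (sum_filter_of_ne (p := fun v => G.degree v ≠ 0) fun v _ hv h => hv ?_).symm
      simp [h]
    have hmaps : ∀ v ∈ univ.filter (fun v => G.degree v ≠ 0),
        G.degree v ∈ (Icc 1 (Fintype.card V)).filter (fun k => 0 < Nk k) := by
      intro v hv
      rw [mem_filter] at hv
      rw [mem_filter, mem_Icc, hNk, card_pos]
      exact ⟨⟨Nat.one_le_iff_ne_zero.mpr hv.2, G.degree_lt_card_verts v |>.le⟩, v, by simp⟩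
    rw [hpos, ← sum_fiberwise_of_maps_to hmaps]
    refine sum_congr rfl fun k hk => ?_
    have hk1 : 1 ≤ k := (mem_Icc.mp (mem_filter.mp hk).1).1
    have hfilter : (univ.filter (fun v => G.degree v ≠ 0)).filter (fun v => G.degree v = k) =
        univ.filter (fun v => G.degree v = k) := by
      ext v
      simp only [mem_filter, mem_univ, true_and]
      omega
    rw [hfilter, hNk, ← nsmul_eq_mul]
    exact sum_eq_card_nsmul fun v hv => by rw [(mem_filter.mp hv).2]
  calc energy G ≤ ∑ v, √(G.degree v : ℝ) := energy_le_sum_sqrt_degree G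
    _ ≤ ∑ k ∈ (Icc 1 (Fintype.card V)).filter (fun k => 0 < Nk k),
          (Nk k : ℝ) * √(3 * (Nk1 k : ℝ) / (Nk k : ℝ) + (k : ℝ)) := by
        rw [hfiber]
        gcongr
        exact le_add_of_nonneg_left (by positivity)
    _ ≤ _ := le_add_of_nonneg_left (by positivity)

end GraphEnergy
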